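/- Let w(n) be an increasing sequence of positive real numbers with w(n) = o(log n) as n → ∞. Then there exist complex coefficients (a_n)_{n≥1} satisfying ∑_{n=1}^∞ |a_n|² w(n) < ∞ and a permutation σ of the positive integers such that the series ∑_{n=1}^∞ a_n e^{2πi σ(n) x} diverges (its partial sums fail to converge) for almost every x ∈ 𝕋. -/

import Mathlib

open MeasureTheory Filter

/-- The complex exponential `e^{2πinx}`. -/
noncomputable def trigChar (n : ℤ) (x : ℝ) : ℂ :=
  Complex.exp (2 * Real.pi * Complex.I * n * x)


namespace WM

open AddCircle

abbrev Circ := UnitAddCircle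

abbrev TL := List (ℤ × ℂ)

noncomputable def ev (l : TL) (x : Circ) : ℂ := (l.map (fun t => t.2 * fourier t.1 x)).sum

/-- the `3/2`-norm -/
noncomputable def pn (z : ℂ) : ℝ := ‖z‖ * Real.sqrt ‖z‖

noncomputable def nn (l : TL) : ℝ := (l.map (fun t => pn t.2)).sum

noncomputable def en (l : TL) : ℝ := (l.map (fun t => ‖t.2‖ ^ 2)).sum

noncomputable def mulL (l g : TL) : TL :=
  l.flatMap (fun s => g.map (fun t => (s.1 + t.1, s.2 * t.2)))

noncomputable def I2 (f : Circ → ℂ) : ENNReal :=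
  ∫⁻ x, ENNReal.ofReal (‖f x‖ ^ 2) ∂(haarAddCircle (T := (1:ℝ)))

@[simp] lemma ev_nil (x : Circ) : ev [] x = 0 := by simp [ev]
@[simp] lemma ev_cons (t : ℤ × ℂ) (l : TL) (x : Circ) :
    ev (t :: l) x = t.2 * fourier t.1 x + ev l x := by simp [ev]
@[simp] lemma ev_append (l g : TL) (x : Circ) : ev (l ++ g) x = ev l x + ev g x := by simp [ev]
@[simp] lemma nn_nil : nn [] = 0 := by simp [nn]
@[simp] lemma nn_cons (t : ℤ × ℂ) (l : TL) : nn (t :: l) = pn t.2 + nn l := by simp [nn]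
@[simp] lemma nn_append (l g : TL) : nn (l ++ g) = nn l + nn g := by simp [nn]
@[simp] lemma en_nil : en [] = 0 := by simp [en]
@[simp] lemma en_cons (t : ℤ × ℂ) (l : TL) : en (t :: l) = ‖t.2‖ ^ 2 + en l := by simp [en]
@[simp] lemma en_append (l g : TL) : en (l ++ g) = en l + en g := by simp [en]

lemma pn_nonneg (z : ℂ) : 0 ≤ pn z := by unfold pn; positivity
lemma pn_mul (a b : ℂ) : pn (a * b) = pn a * pn b := by
  unfold pn; rw [norm_mul, Real.sqrt_mul (norm_nonneg _)]; ring
lemma nn_nonneg (l : TL) : 0 ≤ nn l := by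
  induction l with
  | nil => simp
  | cons t l ih => have := pn_nonneg t.2; simp; linarith
lemma en_nonneg (l : TL) : 0 ≤ en l := by
  induction l with
  | nil => simp
  | cons t l ih => have := sq_nonneg ‖t.2‖; simp; linarith

lemma measurable_ev (l : TL) : Measurable (ev l) := by
  induction l with
  | nil => unfold ev; simp
  | cons t l ih =>
    have : ev (t :: l) = fun x => t.2 * fourier t.1 x + ev l x := by ext x; simp
    rw [this]
    exact ((fourier t.1).continuous.measurable.const_mul _).add ih

lemma ev_shift (s : ℤ × ℂ) (g : TL) (x : Circ) :
    ev (g.map (fun t => (s.1 + t.1, s.2 * t.2))) x = s.2 * fourier s.1 x * ev g x := by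
  induction g with
  | nil => simp
  | cons t l ih =>
    rw [List.map_cons, ev_cons, ih, ev_cons]
    simp only [fourier_add]
    ring

lemma nn_shift (s : ℤ × ℂ) (g : TL) :
    nn (g.map (fun t => (s.1 + t.1, s.2 * t.2))) = pn s.2 * nn g := by
  induction g with
  | nil => simp
  | cons t l ih =>
    rw [List.map_cons, nn_cons, ih, nn_cons]
    simp only [pn_mul]
    ring

@[simp] lemma mulL_nil (g : TL) : mulL [] g = [] := by simp [mulL]

lemma mulL_cons (t : ℤ × ℂ) (l g : TL) :
    mulL (t :: l) g = g.map (fun u => (t.1 + u.1, t.2 * u.2)) ++ mulL l g := by simp [mulL]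

lemma mulL_append (l l' g : TL) : mulL (l ++ l') g = mulL l g ++ mulL l' g := by simp [mulL]

lemma ev_mulL (l g : TL) (x : Circ) : ev (mulL l g) x = ev l x * ev g x := by
  induction l with
  | nil => simp
  | cons t l ih => rw [mulL_cons, ev_append, ev_shift, ih, ev_cons]; ring

lemma nn_mulL (l g : TL) : nn (mulL l g) = nn l * nn g := by
  induction l with
  | nil => simp
  | cons t l ih => rw [mulL_cons, nn_append, nn_shift, ih, nn_cons]; ring

lemma mem_mulL {l g : TL} {u : ℤ × ℂ} (h : u ∈ mulL l g) :
    ∃ s ∈ l, ∃ t ∈ g, u.1 = s.1 + t.1 := by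
  simp only [mulL, List.mem_flatMap, List.mem_map] at h
  obtain ⟨s, hs, t, ht, rfl⟩ := h
  exact ⟨s, hs, t, ht, rfl⟩

/-- separation -/
def Sep (M : ℤ) (l : TL) : Prop := l.Pairwise (fun s t => M < |s.1 - t.1|)

lemma sep_mulL {M M1 D : ℤ} {l g : TL} (hl : Sep M1 l) (hg : Sep M g)
    (hD : ∀ t ∈ g, |t.1| ≤ D) (hM : M + 2 * D ≤ M1) : Sep M (mulL l g) := by
  unfold Sep mulL
  rw [List.pairwise_flatMap]
  constructor
  · intro s _
    rw [List.pairwise_map]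
    refine List.Pairwise.imp ?_ hg
    intro a b hab
    simpa using hab
  · refine List.Pairwise.imp ?_ hl
    intro a b hab x hx y hy
    simp only [List.mem_map] at hx hy
    obtain ⟨t, ht, rfl⟩ := hx
    obtain ⟨u, hu, rfl⟩ := hy
    have h1 := hD t ht
    have h2 := hD u hu
    simp only
    rw [abs_le] at h1 h2
    rcases lt_abs.1 hab with h | h
    · exact lt_abs.2 (Or.inl (by linarith))
    · exact lt_abs.2 (Or.inr (by linarith))

lemma exists_bd (l : TL) : ∃ D : ℤ, 0 ≤ D ∧ ∀ t ∈ l, |t.1| ≤ D := by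
  induction l with
  | nil => exact ⟨0, le_rfl, by simp⟩
  | cons t l ih =>
    obtain ⟨D, h0, hD⟩ := ih
    refine ⟨max D |t.1|, le_max_of_le_left h0, ?_⟩
    intro u hu
    rcases List.mem_cons.1 hu with rfl | hu
    · exact le_max_right _ _
    · exact (hD u hu).trans (le_max_left _ _)

lemma ev_bdd (l : TL) : ∃ B : ℝ, 1 ≤ B ∧ ∀ x, ‖ev l x‖ ≤ B := by
  induction l with
  | nil => exact ⟨1, le_rfl, by simp⟩
  | cons t l ih =>
    obtain ⟨B, h0, hB⟩ := ih
    refine ⟨B + ‖t.2‖, by have := norm_nonneg t.2; linarith, fun x => ?_⟩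
    rw [ev_cons]
    refine (norm_add_le _ _).trans ?_
    rw [norm_mul]
    have : ‖fourier t.1 x‖ = 1 := by rw [fourier_apply]; exact Circle.norm_coe _
    rw [this]
    have := hB x
    linarith

lemma I2_le {f g h : Circ → ℂ} {a b : ℝ} (ha : 0 ≤ a) (hb : 0 ≤ b) (hg : Measurable g)
    (H : ∀ x, ‖f x‖ ^ 2 ≤ a * ‖g x‖ ^ 2 + b * ‖h x‖ ^ 2) :
    I2 f ≤ ENNReal.ofReal a * I2 g + ENNReal.ofReal b * I2 h := by
  unfold I2
  rw [← lintegral_const_mul' _ _ ENNReal.ofReal_ne_top, ← lintegral_const_mul' _ _ ENNReal.ofReal_ne_top,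
    ← lintegral_add_left]
  · refine lintegral_mono fun x => ?_
    rw [← ENNReal.ofReal_mul ha, ← ENNReal.ofReal_mul hb, ← ENNReal.ofReal_add (by positivity) (by positivity)]
    exact ENNReal.ofReal_le_ofReal (H x)
  · fun_prop

lemma I2_Lp (f : Lp ℂ 2 (haarAddCircle (T := (1:ℝ)))) : I2 f = ENNReal.ofReal (‖f‖ ^ 2) := by
  rw [Lp.norm_def, ← ENNReal.toReal_pow, ENNReal.ofReal_toReal (by
    exact ENNReal.pow_ne_top (Lp.eLpNorm_ne_top f))]
  rw [eLpNorm_eq_lintegral_rpow_enorm_toReal (by norm_num) (by norm_num)]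
  simp only [ENNReal.toReal_ofNat, ENNReal.rpow_ofNat, one_div]
  rw [← ENNReal.rpow_natCast, ← ENNReal.rpow_mul]
  norm_num
  unfold I2
  refine lintegral_congr fun x => ?_
  rw [ENNReal.ofReal_pow (norm_nonneg _), ofReal_norm]

lemma I2_congr {f g : Circ → ℂ} (h : f =ᵐ[haarAddCircle (T := (1:ℝ))] g) : I2 f = I2 g := by
  unfold I2
  refine lintegral_congr_ae ?_
  filter_upwards [h] with x hx
  rw [hx]

noncomputable def evp (l : TL) : Lp ℂ 2 (haarAddCircle (T := (1:ℝ))) :=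
  (l.map (fun t => t.2 • fourierLp 2 t.1)).sum

lemma evp_coe (l : TL) : (evp l : Circ → ℂ) =ᵐ[haarAddCircle (T := (1:ℝ))] ev l := by
  induction l with
  | nil =>
    have : evp [] = 0 := by simp [evp]
    rw [this]
    filter_upwards [Lp.coeFn_zero ℂ 2 (haarAddCircle (T := (1:ℝ)))] with x hx
    rw [hx]; simp
  | cons t l ih =>
    have : evp (t :: l) = t.2 • fourierLp 2 t.1 + evp l := by simp [evp]
    rw [this]
    filter_upwards [Lp.coeFn_add (t.2 • fourierLp 2 t.1) (evp l), ih,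
      Lp.coeFn_smul t.2 (fourierLp (T := (1:ℝ)) 2 t.1), coeFn_fourierLp (T := (1:ℝ)) 2 t.1] with x h1 h2 h3 h4
    rw [h1, Pi.add_apply, h2, h3, Pi.smul_apply, h4]; simp

lemma inner_evp (n : ℤ) (l : TL) (h : ∀ t ∈ l, n ≠ t.1) :
    inner ℂ (fourierLp (T := (1:ℝ)) 2 n) (evp l) = 0 := by
  induction l with
  | nil => simp [evp]
  | cons t l ih =>
    have : evp (t :: l) = t.2 • fourierLp 2 t.1 + evp l := by simp [evp]
    rw [this, inner_add_right, ih (fun u hu => h u (List.mem_cons_of_mem _ hu)), inner_smul_right,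
      orthonormal_fourier.2 (h t List.mem_cons_self)]
    simp

lemma norm_evp (l : TL) (h : Sep 0 l) : ‖evp l‖ ^ 2 = en l := by
  induction l with
  | nil => simp [evp]
  | cons t l ih =>
    have : evp (t :: l) = t.2 • fourierLp 2 t.1 + evp l := by simp [evp]
    unfold Sep at h ih
    rw [List.pairwise_cons] at h
    rw [this, @norm_add_sq ℂ, inner_smul_left, inner_evp, ih h.2, norm_smul,
      orthonormal_fourier.1, en_cons]
    · simp
    · intro u hu
      have := h.1 u hu
      intro h'
      rw [h'] at this
      simp at this

lemma parseval (l : TL) (h : Sep 0 l) : I2 (ev l) = ENNReal.ofReal (en l) := by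
  rw [← I2_congr (evp_coe l), I2_Lp, norm_evp l h]


noncomputable def rr (x : Circ) : ℝ :=
  if ((measurableEquivIoc (1:ℝ) 0 x : Set.Ioc (0:ℝ) (0 + 1)) : ℝ) ≤ 1 / 2 then 1 else -1

lemma rr_cases (x : Circ) : rr x = 1 ∨ rr x = -1 := by
  unfold rr; split_ifs <;> simp

lemma measurable_rr : Measurable rr := by
  unfold rr
  refine Measurable.ite ?_ measurable_const measurable_const
  exact measurableSet_le (measurable_subtype_coe.comp (measurableEquivIoc (1:ℝ) 0).measurable)
    measurable_const

lemma rr_coe {t : ℝ} (h : t ∈ Set.Ioc (0:ℝ) 1) : rr (t : Circ) = if t ≤ 1 / 2 then 1 else -1 := by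
  have h' : t ∈ Set.Ioc (0:ℝ) (0 + 1) := by simpa using h
  have : ((measurableEquivIoc (1:ℝ) 0 (t : Circ) : Set.Ioc (0:ℝ) (0 + 1)) : ℝ) = t := by
    change ((equivIoc (1:ℝ) 0 (t : Circ) : Set.Ioc (0:ℝ) (0 + 1)) : ℝ) = t
    rw [AddCircle.equivIoc_coe_eq h']
  unfold rr
  rw [this]

lemma coeff_rr (n : ℤ) : fourierCoeff (fun x : Circ => ((rr x : ℝ) : ℂ)) n =
    (∫ t in (0:ℝ)..(1/2), fourier (-n) (t : Circ)) - ∫ t in (1/2:ℝ)..1, fourier (-n) (t : Circ) := by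
  have hc : Continuous (fun t : ℝ => fourier (-n) (t : Circ)) :=
    (fourier (-n)).continuous.comp (AddCircle.continuous_mk' 1)
  rw [fourierCoeff_eq_intervalIntegral _ n 0]
  have e1 : Set.EqOn (fun t : ℝ => fourier (-n) (t : Circ) • ((rr t : ℝ) : ℂ))
      (fun t => fourier (-n) (t : Circ)) (Set.uIoc 0 (1/2)) := by
    intro t ht
    rw [Set.uIoc_of_le (by norm_num)] at ht
    simp only
    rw [rr_coe ⟨ht.1, ht.2.trans (by norm_num)⟩, if_pos ht.2]; simp
  have e2 : Set.EqOn (fun t : ℝ => fourier (-n) (t : Circ) • ((rr t : ℝ) : ℂ))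
      (fun t => - fourier (-n) (t : Circ)) (Set.uIoc (1/2) 1) := by
    intro t ht
    rw [Set.uIoc_of_le (by norm_num)] at ht
    simp only
    rw [rr_coe ⟨lt_trans (by norm_num) ht.1, ht.2⟩, if_neg (not_le.2 ht.1)]; simp
  rw [zero_add, ← intervalIntegral.integral_add_adjacent_intervals (b := 1/2)]
  · rw [intervalIntegral.integral_congr_ae (Eventually.of_forall e1), intervalIntegral.integral_congr_ae (Eventually.of_forall e2),
      intervalIntegral.integral_neg]
    simp [sub_eq_add_neg]
  · exact (hc.intervalIntegrable _ _).congr e1.symm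
  · exact (hc.neg.intervalIntegrable _ _).congr e2.symm

lemma coeff_rr_zero : fourierCoeff (fun x : Circ => ((rr x : ℝ) : ℂ)) 0 = 0 := by
  rw [coeff_rr]; simp; norm_num

lemma int_bd (n : ℤ) (hn : n ≠ 0) (a b : ℝ) :
    ‖∫ t in a..b, fourier (-n) (t : Circ)‖ ≤ 1 / (2 * |(n:ℝ)|) := by
  have hn' : (0:ℝ) < |(n:ℝ)| := by positivity
  have : (fun t : ℝ => fourier (-n) (t : Circ)) =
      fun t : ℝ => Complex.exp ((2 * Real.pi * Complex.I * (-n : ℤ)) * t) := by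
    ext t; rw [fourier_coe_apply]; simp
  rw [this, integral_exp_mul_complex]
  · rw [norm_div]
    have h1 : ∀ s : ℝ, ‖Complex.exp ((2 * Real.pi * Complex.I * (-n : ℤ)) * s)‖ = 1 := by
      intro s
      rw [Complex.norm_exp]
      simp
    have h2 : ‖(2 * Real.pi * Complex.I * (-n : ℤ) : ℂ)‖ = 2 * Real.pi * |(n:ℝ)| := by
      simp [abs_of_pos Real.pi_pos]
    rw [h2]
    have h3 : ‖Complex.exp ((2 * Real.pi * Complex.I * (-n : ℤ)) * b) -
      Complex.exp ((2 * Real.pi * Complex.I * (-n : ℤ)) * a)‖ ≤ 2 := by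
      refine (norm_sub_le _ _).trans ?_
      rw [h1, h1]; norm_num
    rw [div_le_div_iff₀ (by positivity) (by positivity)]
    have := Real.pi_gt_three
    nlinarith [mul_pos hn' hn']
  · simp [hn, Real.pi_ne_zero]

lemma coeff_rr_bd (n : ℤ) (hn : n ≠ 0) :
    ‖fourierCoeff (fun x : Circ => ((rr x : ℝ) : ℂ)) n‖ ≤ |(n:ℝ)|⁻¹ := by
  rw [coeff_rr]
  refine (norm_sub_le _ _).trans ((add_le_add (int_bd n hn _ _) (int_bd n hn _ _)).trans ?_)
  have hn' : (0:ℝ) < |(n:ℝ)| := by positivity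
  field_simp; norm_num

lemma pn_coeff (n : ℤ) (hn : n ≠ 0) :
    pn (fourierCoeff (fun x : Circ => ((rr x : ℝ) : ℂ)) n) ≤ |(n:ℝ)| ^ (-(3/2:ℝ)) := by
  have hn' : (0:ℝ) < |(n:ℝ)| := by positivity
  unfold pn
  have : |(n:ℝ)| ^ (-(3/2:ℝ)) = |(n:ℝ)|⁻¹ * Real.sqrt (|(n:ℝ)|⁻¹) := by
    rw [Real.sqrt_eq_rpow, ← Real.rpow_neg_one, ← Real.rpow_mul hn'.le, ← Real.rpow_add hn']
    norm_num
  rw [this]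
  have := coeff_rr_bd n hn
  gcongr

lemma exists_q : ∃ K0 : ℝ, 0 ≤ K0 ∧ ∀ δ : ℝ, 0 < δ → ∃ q : TL, Sep 0 q ∧ (∀ t ∈ q, t.1 ≠ 0) ∧
    nn q ≤ K0 ∧ I2 (fun x => (rr x : ℂ) - ev q x) ≤ ENNReal.ofReal δ := by
  have hs : Summable (fun n : ℤ => |(n:ℝ)| ^ (-(3/2:ℝ))) := Real.summable_abs_int_rpow (by norm_num)
  refine ⟨∑' n : ℤ, |(n:ℝ)| ^ (-(3/2:ℝ)), tsum_nonneg (fun n => by positivity), fun δ hδ => ?_⟩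
  have hmeas : Measurable (fun x : Circ => ((rr x : ℝ) : ℂ)) :=
    Complex.measurable_ofReal.comp measurable_rr
  have hmem : MemLp (fun x : Circ => ((rr x : ℝ) : ℂ)) 2 (haarAddCircle (T := (1:ℝ))) := by
    refine MemLp.of_bound hmeas.aestronglyMeasurable 1 (Eventually.of_forall fun x => ?_)
    rcases rr_cases x with h | h <;> simp [h]
  set f := hmem.toLp with hf
  have hfc : (f : Circ → ℂ) =ᵐ[haarAddCircle (T := (1:ℝ))] (fun x : Circ => ((rr x : ℝ) : ℂ)) :=
    hmem.coeFn_toLp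
  have hcoef : ∀ n, fourierCoeff (f : Circ → ℂ) n =
      fourierCoeff (fun x : Circ => ((rr x : ℝ) : ℂ)) n := by
    intro n
    unfold fourierCoeff
    refine integral_congr_ae ?_
    filter_upwards [hfc] with x hx
    rw [hx]
  have hS := hasSum_fourier_series_L2 f
  simp only [hcoef] at hS
  obtain ⟨s, hsb⟩ := (Metric.tendsto_atTop.1 hS (Real.sqrt δ) (Real.sqrt_pos.2 hδ))
  have hsb := hsb s le_rfl
  rw [dist_comm, dist_eq_norm] at hsb
  set c := fun n => fourierCoeff (fun x : Circ => ((rr x : ℝ) : ℂ)) n with hc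
  set q : TL := (s.erase 0).toList.map (fun n => (n, c n)) with hq
  have hevp : evp q = ∑ n ∈ s, c n • fourierLp (T := (1:ℝ)) 2 n := by
    rw [hq]
    unfold evp
    rw [List.map_map]
    have : (List.map ((fun t : ℤ × ℂ => t.2 • fourierLp (T := (1:ℝ)) 2 t.1) ∘ fun n => (n, c n))
      (s.erase 0).toList).sum = ∑ n ∈ s.erase 0, c n • fourierLp (T := (1:ℝ)) 2 n := by
      rw [← Finset.sum_map_toList]; rfl
    rw [this]
    refine Finset.sum_erase _ ?_
    simp only [hc]
    rw [coeff_rr_zero, zero_smul]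
  refine ⟨q, ?_, ?_, ?_, ?_⟩
  · unfold Sep
    rw [hq, List.pairwise_map]
    refine List.Pairwise.imp ?_ (Finset.nodup_toList (s.erase 0))
    intro a b hab
    simpa [sub_eq_zero] using hab
  · intro t ht
    simp only [hq, List.mem_map, Finset.mem_toList, Finset.mem_erase] at ht
    obtain ⟨n, hn, rfl⟩ := ht
    exact hn.1
  · unfold nn
    rw [hq, List.map_map]
    have : (List.map ((fun t : ℤ × ℂ => pn t.2) ∘ fun n => (n, c n))
      (s.erase 0).toList).sum = ∑ n ∈ s.erase 0, pn (c n) := by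
      rw [← Finset.sum_map_toList]; rfl
    rw [this]
    refine le_trans (Finset.sum_le_sum (g := fun n : ℤ => |(n:ℝ)| ^ (-(3/2:ℝ))) ?_) (hs.sum_le_tsum _ (fun n _ => by positivity))
    intro n hn
    exact pn_coeff n (Finset.mem_erase.1 hn).1
  · have : (fun x => (rr x : ℂ) - ev q x) =ᵐ[haarAddCircle (T := (1:ℝ))]
        ((f - evp q : Lp ℂ 2 (haarAddCircle (T := (1:ℝ)))) : Circ → ℂ) := by
      filter_upwards [hfc, evp_coe q, Lp.coeFn_sub f (evp q)] with x h1 h2 h3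
      rw [h3, Pi.sub_apply, h1, h2]
    rw [I2_congr this, I2_Lp, hevp]
    refine ENNReal.ofReal_le_ofReal ?_
    rw [← Real.sqrt_le_sqrt_iff hδ.le, Real.sqrt_sq (norm_nonneg _)]
    exact hsb.le

lemma I2_dil (f : Circ → ℂ) (hf : Measurable f) (M : ℤ) (hM : M ≠ 0) :
    I2 (fun x => f (M • x)) = I2 f := by
  have h := (Measure.measurePreserving_zsmul (haarAddCircle (T := (1:ℝ))) hM)
  unfold I2
  exact h.lintegral_comp (f := fun x => ENNReal.ofReal (‖f x‖ ^ 2)) (by fun_prop)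

lemma ev_dil (l : TL) (M : ℤ) (x : Circ) :
    ev (l.map (fun t => (M * t.1, t.2))) x = ev l (M • x) := by
  induction l with
  | nil => simp
  | cons t l ih =>
    rw [List.map_cons, ev_cons, ih, ev_cons]
    simp only [fourier_apply]
    rw [smul_smul, mul_comm M]


abbrev Nd := (Circ → ℝ) × TL

noncomputable def sH (T : List Nd) (x : Circ) : ℝ := (T.map (fun p => p.1 x)).sum
noncomputable def sH2 (T : List Nd) (x : Circ) : ℝ := (T.map (fun p => p.1 x ^ 2)).sum
def fl (T : List Nd) : TL := T.flatMap (fun p => p.2)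

@[simp] lemma sH_nil (x : Circ) : sH [] x = 0 := by simp [sH]
@[simp] lemma sH_cons (p : Nd) (T : List Nd) (x : Circ) : sH (p :: T) x = p.1 x + sH T x := by
  simp [sH]
@[simp] lemma sH_append (T S : List Nd) (x : Circ) : sH (T ++ S) x = sH T x + sH S x := by
  simp [sH]
@[simp] lemma sH2_nil (x : Circ) : sH2 [] x = 0 := by simp [sH2]
@[simp] lemma sH2_cons (p : Nd) (T : List Nd) (x : Circ) : sH2 (p :: T) x = p.1 x ^ 2 + sH2 T x := by
  simp [sH2]
@[simp] lemma sH2_append (T S : List Nd) (x : Circ) : sH2 (T ++ S) x = sH2 T x + sH2 S x := by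
  simp [sH2]
@[simp] lemma fl_nil : fl [] = [] := by simp [fl]
@[simp] lemma fl_cons (p : Nd) (T : List Nd) : fl (p :: T) = p.2 ++ fl T := by simp [fl]
@[simp] lemma fl_append (T S : List Nd) : fl (T ++ S) = fl T ++ fl S := by simp [fl]

structure Good (K : ℝ) (k : ℕ) (M : ℤ) (δ : ℝ) (T : List Nd) : Prop where
  len : T.length < 2 ^ k
  split : ∀ x, ∃ T1 T2, T = T1 ++ T2 ∧ sH T1 x - sH T2 x = k
  sq : ∀ x, sH2 T x ≤ k
  meas : ∀ p ∈ T, Measurable p.1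
  bd : ∀ p ∈ T, ∀ x, |p.1 x| ≤ 1
  nnb : ∀ p ∈ T, nn p.2 ≤ K ^ k
  err : ∀ p ∈ T, I2 (fun x => (p.1 x : ℂ) - ev p.2 x) ≤ ENNReal.ofReal δ
  sep : Sep M (fl T)
  far : ∀ t ∈ fl T, M < |t.1|

noncomputable def gg (s : ℝ) (q : TL) : TL :=
  ((0:ℤ), (1/2 : ℂ)) :: q.map (fun t => ((0:ℤ) + t.1, ((s:ℂ)/2) * t.2))

lemma ev_gg (s : ℝ) (q : TL) (x : Circ) : ev (gg s q) x = 1/2 + (s:ℂ)/2 * ev q x := by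
  unfold gg
  rw [ev_cons]
  have := ev_shift ((0:ℤ), ((s:ℂ)/2)) q x
  simp only at this
  rw [this]
  simp

noncomputable def tr (s : ℝ) (ρ : Circ → ℝ) (q : TL) (p : Nd) : Nd :=
  (fun x => (1 + s * ρ x) / 2 * p.1 x, mulL p.2 (gg s q))

lemma fl_tr (s : ℝ) (ρ : Circ → ℝ) (q : TL) (T : List Nd) :
    fl (T.map (tr s ρ q)) = mulL (fl T) (gg s q) := by
  induction T with
  | nil => simp
  | cons p T ih => rw [List.map_cons, fl_cons, ih, fl_cons, mulL_append]; rfl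

lemma sH_tr (s : ℝ) (ρ : Circ → ℝ) (q : TL) (T : List Nd) (x : Circ) :
    sH (T.map (tr s ρ q)) x = (1 + s * ρ x) / 2 * sH T x := by
  induction T with
  | nil => simp
  | cons p T ih => rw [List.map_cons, sH_cons, ih, sH_cons]; simp only [tr]; ring

lemma sH2_tr (s : ℝ) (ρ : Circ → ℝ) (q : TL) (T : List Nd) (x : Circ) :
    sH2 (T.map (tr s ρ q)) x = ((1 + s * ρ x) / 2) ^ 2 * sH2 T x := by
  induction T with
  | nil => simp
  | cons p T ih => rw [List.map_cons, sH2_cons, ih, sH2_cons]; simp only [tr]; ring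

lemma pn_small (z : ℂ) (h : ‖z‖ ≤ 1) : pn z ≤ 1 := by
  unfold pn
  have : Real.sqrt ‖z‖ ≤ 1 := Real.sqrt_le_one.2 h
  have h2 := Real.sqrt_nonneg ‖z‖
  nlinarith [norm_nonneg z]

lemma nn_gg (s : ℝ) (hs : s = 1 ∨ s = -1) (q : TL) : nn (gg s q) ≤ 1 + nn q := by
  unfold gg
  rw [nn_cons]
  have := nn_shift ((0:ℤ), ((s:ℂ)/2)) q
  simp only at this
  rw [this]
  have h1 : pn (1/2 : ℂ) ≤ 1 := pn_small _ (by norm_num)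
  have h2 : pn ((s:ℂ)/2) ≤ 1 := pn_small _ (by rcases hs with rfl | rfl <;> norm_num)
  have := nn_nonneg q
  simp only
  nlinarith

/-- per-node facts after transformation -/
lemma tr_node {K0 δ B : ℝ} {k : ℕ} (hδ : 0 < δ) (hB : 1 ≤ B) (s : ℝ) (hs : s = 1 ∨ s = -1)
    (ρ : Circ → ℝ) (hρ : ∀ x, ρ x = 1 ∨ ρ x = -1) (hρm : Measurable ρ)
    (q : TL) (hq : ∀ x, ‖ev q x‖ ≤ B) (hqn : nn q ≤ K0)
    (hqe : I2 (fun x => (ρ x : ℂ) - ev q x) ≤ ENNReal.ofReal δ)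
    (p : Nd) (hm : Measurable p.1) (hb : ∀ x, |p.1 x| ≤ 1) (hn : nn p.2 ≤ (1 + K0) ^ k)
    (he : I2 (fun x => (p.1 x : ℂ) - ev p.2 x) ≤ ENNReal.ofReal (δ / (4 * B ^ 2))) :
    Measurable (tr s ρ q p).1 ∧ (∀ x, |(tr s ρ q p).1 x| ≤ 1) ∧
    nn (tr s ρ q p).2 ≤ (1 + K0) ^ (k + 1) ∧
    I2 (fun x => ((tr s ρ q p).1 x : ℂ) - ev (tr s ρ q p).2 x) ≤ ENNReal.ofReal δ := by
  have hK0 : 0 ≤ K0 := (nn_nonneg q).trans hqn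
  refine ⟨?_, ?_, ?_, ?_⟩
  · unfold tr; simp only; fun_prop
  · intro x
    simp only [tr]
    rw [abs_mul]
    have h1 : |(1 + s * ρ x) / 2| ≤ 1 := by
      rcases hs with rfl | rfl <;> rcases hρ x with h | h <;> rw [h] <;> norm_num
    have := hb x
    have h3 := abs_nonneg (p.1 x)
    have h4 := abs_nonneg ((1 + s * ρ x) / 2)
    nlinarith
  · simp only [tr]
    rw [nn_mulL, pow_succ]
    have h1 := nn_gg s hs q
    have h2 := nn_nonneg (gg s q)
    have h3 := nn_nonneg p.2
    exact mul_le_mul hn (by linarith) h2 (by positivity)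
  · have key := I2_le (f := fun x => ((tr s ρ q p).1 x : ℂ) - ev (tr s ρ q p).2 x)
      (g := fun x => (ρ x : ℂ) - ev q x) (h := fun x => (p.1 x : ℂ) - ev p.2 x)
      (a := 1/2) (b := 2 * B ^ 2) (by norm_num) (by positivity)
      ((Complex.measurable_ofReal.comp hρm).sub (measurable_ev q)) ?_
    · refine key.trans ?_
      calc _ ≤ ENNReal.ofReal (1/2) * ENNReal.ofReal δ +
            ENNReal.ofReal (2 * B ^ 2) * ENNReal.ofReal (δ / (4 * B ^ 2)) := by gcongr
        _ = ENNReal.ofReal δ := by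
          rw [← ENNReal.ofReal_mul (by norm_num), ← ENNReal.ofReal_mul (by positivity),
            ← ENNReal.ofReal_add (by positivity) (by positivity)]
          congr 1
          field_simp
          ring
    · intro x
      simp only [tr]
      rw [ev_mulL, ev_gg]
      have e : ((((1 + s * ρ x) / 2 * p.1 x : ℝ)) : ℂ) - ev p.2 x * (1/2 + (s:ℂ)/2 * ev q x) =
        ((s:ℂ)/2 * (p.1 x : ℂ)) * ((ρ x : ℂ) - ev q x) +
          (1/2 + (s:ℂ)/2 * ev q x) * ((p.1 x : ℂ) - ev p.2 x) := by
        push_cast; ring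
      rw [e]
      have hs' : ‖(s:ℂ)/2‖ = 1/2 := by rcases hs with rfl | rfl <;> norm_num
      have n1 : ‖((s:ℂ)/2 * (p.1 x : ℂ)) * ((ρ x : ℂ) - ev q x)‖ ≤ 1/2 * ‖(ρ x : ℂ) - ev q x‖ := by
        rw [norm_mul, norm_mul, hs', Complex.norm_real]
        have := hb x
        rw [Real.norm_eq_abs]
        gcongr
        linarith
      have n2 : ‖(1/2 + (s:ℂ)/2 * ev q x) * ((p.1 x : ℂ) - ev p.2 x)‖ ≤
          B * ‖(p.1 x : ℂ) - ev p.2 x‖ := by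
        rw [norm_mul]
        gcongr
        refine (norm_add_le _ _).trans ?_
        rw [norm_mul, hs']
        have := hq x
        norm_num
        linarith
      have n3 := norm_add_le (((s:ℂ)/2 * (p.1 x : ℂ)) * ((ρ x : ℂ) - ev q x))
        ((1/2 + (s:ℂ)/2 * ev q x) * ((p.1 x : ℂ) - ev p.2 x))
      set u := ‖(ρ x : ℂ) - ev q x‖
      set v := ‖(p.1 x : ℂ) - ev p.2 x‖
      have n4 : ‖((s:ℂ)/2 * (p.1 x : ℂ)) * ((ρ x : ℂ) - ev q x) +
        (1/2 + (s:ℂ)/2 * ev q x) * ((p.1 x : ℂ) - ev p.2 x)‖ ≤ 1/2 * u + B * v := by linarith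
      calc _ ≤ (1/2 * u + B * v) ^ 2 := by gcongr
        _ ≤ _ := by nlinarith [sq_nonneg (1/2 * u - B * v)]

lemma sep_gg {M0 : ℤ} (h0 : 0 ≤ M0) (s : ℝ) (q : TL) (hq : Sep 0 q) (hq0 : ∀ t ∈ q, t.1 ≠ 0) :
    Sep M0 (q.map (fun t => ((M0 + 1) * t.1, t.2))) ∧
    (∀ t ∈ q.map (fun t => ((M0 + 1) * t.1, t.2)), M0 < |t.1|) ∧
    Sep M0 (gg s (q.map (fun t => ((M0 + 1) * t.1, t.2)))) := by
  have hd : ∀ n : ℤ, n ≠ 0 → M0 < |(M0 + 1) * n| := by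
    intro n hn
    rw [abs_mul, abs_of_pos (by linarith : 0 < M0 + 1)]
    have : 1 ≤ |n| := Int.one_le_abs hn
    nlinarith
  have h1 : Sep M0 (q.map (fun t => ((M0 + 1) * t.1, t.2))) := by
    unfold Sep
    rw [List.pairwise_map]
    refine List.Pairwise.imp ?_ hq
    intro a b hab
    simp only
    rw [← mul_sub]
    exact hd _ (abs_pos.1 hab)
  have h2 : (∀ t ∈ q.map (fun t => ((M0 + 1) * t.1, t.2)), M0 < |t.1|) := by
    intro t ht
    obtain ⟨u, hu, rfl⟩ := List.mem_map.1 ht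
    exact hd _ (hq0 u hu)
  refine ⟨h1, h2, ?_⟩
  unfold gg Sep
  rw [List.pairwise_cons]
  constructor
  · intro t ht
    obtain ⟨u, hu, rfl⟩ := List.mem_map.1 ht
    simpa using h2 u hu
  · rw [List.pairwise_map]
    refine List.Pairwise.imp ?_ h1
    intro a b hab
    simpa using hab

lemma exists_tree : ∃ K : ℝ, 1 ≤ K ∧ ∀ k : ℕ, ∀ M0 : ℤ, 0 ≤ M0 → ∀ δ : ℝ, 0 < δ →
    ∃ T, Good K k M0 δ T := by
  obtain ⟨K0, hK0, hR⟩ := exists_q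
  refine ⟨1 + K0, by linarith, fun k => ?_⟩
  induction k with
  | zero =>
    intro M0 h0 δ hδ
    refine ⟨[], ?_, ?_, ?_, ?_, ?_, ?_, ?_, ?_, ?_⟩
    · simp
    · intro x; exact ⟨[], [], by simp, by simp⟩
    · simp
    · simp
    · simp
    · simp
    · simp
    · simp [Sep]
    · simp
  | succ k ih =>
    intro M0 h0 δ hδ
    obtain ⟨q0, hq1, hq2, hq3, hq4⟩ := hR δ hδ
    have hM : M0 + 1 ≠ 0 := by linarith
    obtain ⟨B, hB1, hB⟩ := ev_bdd q0
    set q := q0.map (fun t => ((M0 + 1) * t.1, t.2)) with hq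
    set ρ : Circ → ℝ := fun x => rr ((M0 + 1) • x) with hρ
    have hevq : ∀ x, ev q x = ev q0 ((M0 + 1) • x) := fun x => ev_dil q0 (M0 + 1) x
    have hρc : ∀ x, ρ x = 1 ∨ ρ x = -1 := fun x => rr_cases _
    have hρm : Measurable ρ := measurable_rr.comp (continuous_zsmul (M0 + 1)).measurable
    have hqB : ∀ x, ‖ev q x‖ ≤ B := fun x => by rw [hevq]; exact hB _
    have hqn : nn q ≤ K0 := by
      have : nn q = nn q0 := by rw [hq]; unfold nn; rw [List.map_map]; rfl
      rw [this]; exact hq3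
    have hqe : I2 (fun x => (ρ x : ℂ) - ev q x) ≤ ENNReal.ofReal δ := by
      simp only [hevq, hρ]
      rw [I2_dil (fun x => (rr x : ℂ) - ev q0 x)
        ((Complex.measurable_ofReal.comp measurable_rr).sub (measurable_ev q0)) _ hM]
      exact hq4
    obtain ⟨D, hD0, hD⟩ := exists_bd q
    have hDg : ∀ s : ℝ, ∀ t ∈ gg s q, |t.1| ≤ D := by
      intro s t ht
      unfold gg at ht
      rcases List.mem_cons.1 ht with rfl | ht
      · simpa using hD0
      · obtain ⟨u, hu, rfl⟩ := List.mem_map.1 ht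
        simpa using hD u hu
    have hsg := fun s => sep_gg h0 s q0 hq1 hq2
    have hδ' : 0 < δ / (4 * B ^ 2) := by positivity
    obtain ⟨T1, G1⟩ := ih (M0 + 2 * D) (by linarith) _ hδ'
    obtain ⟨D1, hD10, hD1⟩ := exists_bd (fl T1)
    obtain ⟨T2, G2⟩ := ih (M0 + 2 * D + D1) (by linarith) _ hδ'
    have n1 := fun p hp => tr_node (K0 := K0) (k := k) hδ hB1 (-1) (Or.inr rfl) ρ hρc hρm q hqB hqn hqe p
      (G1.meas p hp) (G1.bd p hp) (G1.nnb p hp) (G1.err p hp)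
    have n2 := fun p hp => tr_node (K0 := K0) (k := k) hδ hB1 1 (Or.inl rfl) ρ hρc hρm q hqB hqn hqe p
      (G2.meas p hp) (G2.bd p hp) (G2.nnb p hp) (G2.err p hp)
    have hall : ∀ Q : Nd → Prop, (∀ p ∈ T1, Q (tr (-1) ρ q p)) → Q (ρ, q) →
        (∀ p ∈ T2, Q (tr 1 ρ q p)) →
        ∀ p ∈ T1.map (tr (-1) ρ q) ++ (ρ, q) :: T2.map (tr 1 ρ q), Q p := by
      intro Q h1 h2 h3 p hp
      simp only [List.mem_append, List.mem_map, List.mem_cons] at hp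
      rcases hp with ⟨u, hu, rfl⟩ | rfl | ⟨u, hu, rfl⟩
      · exact h1 u hu
      · exact h2
      · exact h3 u hu
    have far1 : ∀ t ∈ mulL (fl T1) (gg (-1) q), M0 + D < |t.1| ∧ |t.1| ≤ D1 + D := by
      intro t ht
      obtain ⟨a, ha, b, hb, e⟩ := mem_mulL ht
      have h1 := G1.far a ha
      have h2 := hDg _ b hb
      have h3 := hD1 a ha
      rw [e]
      rw [abs_le] at *
      constructor
      · rcases lt_abs.1 h1 with h | h
        · exact lt_abs.2 (Or.inl (by linarith))
        · exact lt_abs.2 (Or.inr (by linarith))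
      · constructor <;> linarith
    have far2 : ∀ t ∈ mulL (fl T2) (gg 1 q), M0 + D + D1 < |t.1| := by
      intro t ht
      obtain ⟨a, ha, b, hb, e⟩ := mem_mulL ht
      have h1 := G2.far a ha
      have h2 := hDg _ b hb
      rw [e]
      rw [abs_le] at *
      rcases lt_abs.1 h1 with h | h
      · exact lt_abs.2 (Or.inl (by linarith))
      · exact lt_abs.2 (Or.inr (by linarith))
    have hgap : ∀ (a b : ℤ), M0 < |a| - |b| → M0 < |a - b| := fun a b h =>
      lt_of_lt_of_le h (abs_sub_abs_le_abs_sub a b)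
    refine ⟨T1.map (tr (-1) ρ q) ++ (ρ, q) :: T2.map (tr 1 ρ q), ?_, ?_, ?_, ?_, ?_, ?_, ?_, ?_, ?_⟩
    · have := G1.len
      have := G2.len
      simp only [List.length_append, List.length_map, List.length_cons]
      rw [pow_succ]; omega
    · intro x
      rcases hρc x with h | h
      · obtain ⟨S1, S2, hS, hs⟩ := G2.split x
        refine ⟨T1.map (tr (-1) ρ q) ++ (ρ, q) :: S1.map (tr 1 ρ q), S2.map (tr 1 ρ q), ?_, ?_⟩
        · rw [hS]; simp
        · simp only [sH_append, sH_cons, sH_tr, h]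
          push_cast; linarith
      · obtain ⟨S1, S2, hS, hs⟩ := G1.split x
        refine ⟨S1.map (tr (-1) ρ q), S2.map (tr (-1) ρ q) ++ (ρ, q) :: T2.map (tr 1 ρ q), ?_, ?_⟩
        · rw [hS]; simp
        · simp only [sH_append, sH_cons, sH_tr, h]
          push_cast; linarith
    · intro x
      have a1 := G1.sq x
      have a2 := G2.sq x
      simp only [sH2_append, sH2_cons, sH2_tr]
      push_cast
      rcases hρc x with h | h <;> rw [h] <;> norm_num <;> linarith
    · exact hall (fun p => Measurable p.1) (fun p hp => (n1 p hp).1) hρm (fun p hp => (n2 p hp).1)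
    · refine hall (fun p => ∀ x, |p.1 x| ≤ 1) (fun p hp => (n1 p hp).2.1) ?_ (fun p hp => (n2 p hp).2.1)
      intro x
      rcases hρc x with h | h <;> simp [h]
    · refine hall (fun p => nn p.2 ≤ (1 + K0) ^ (k + 1)) (fun p hp => (n1 p hp).2.2.1) ?_
        (fun p hp => (n2 p hp).2.2.1)
      have : 1 + K0 ≤ (1 + K0) ^ (k + 1) := le_self_pow₀ (by linarith) (by omega)
      simp only
      linarith
    · exact hall (fun p => I2 (fun x => (p.1 x : ℂ) - ev p.2 x) ≤ ENNReal.ofReal δ)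
        (fun p hp => (n1 p hp).2.2.2) hqe (fun p hp => (n2 p hp).2.2.2)
    · simp only [fl_append, fl_cons, fl_tr]
      unfold Sep
      rw [List.pairwise_append, List.pairwise_append]
      refine ⟨sep_mulL G1.sep (hsg _).2.2 (hDg _) le_rfl, ⟨(hsg 1).1,
        sep_mulL G2.sep (hsg _).2.2 (hDg _) (by linarith), ?_⟩, ?_⟩
      · intro a ha b hb
        have := hD a ha
        have := far2 b hb
        rw [abs_sub_comm]
        exact hgap _ _ (by linarith)
      · intro a ha b hb
        have h1 := far1 a ha
        rcases List.mem_append.1 hb with hb | hb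
        · have := hD b hb
          exact hgap _ _ (by linarith)
        · have := far2 b hb
          rw [abs_sub_comm]
          exact hgap _ _ (by linarith)
    · simp only [fl_append, fl_cons, fl_tr]
      intro t ht
      rcases List.mem_append.1 ht with ht | ht
      · linarith [(far1 t ht).1]
      rcases List.mem_append.1 ht with ht | ht
      · exact (hsg 1).2.1 t ht
      · linarith [far2 t ht]


open Classical in
noncomputable def th (s : ℝ) (l : TL) : TL := l.filter (fun t => s ^ 2 ≤ ‖t.2‖)
open Classical in
noncomputable def dr (s : ℝ) (l : TL) : TL := l.filter (fun t => ¬ s ^ 2 ≤ ‖t.2‖)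

lemma ev_th (s : ℝ) (l : TL) (x : Circ) : ev l x = ev (th s l) x + ev (dr s l) x := by
  induction l with
  | nil => simp [th, dr]
  | cons t l ih =>
    unfold th dr at *
    by_cases h : s ^ 2 ≤ ‖t.2‖
    · simp only [List.filter_cons, h, decide_true, if_true, not_true, decide_false, ev_cons, ih]
      simp; ring
    · simp only [List.filter_cons, h, decide_false, not_false_iff, decide_true, if_true, ev_cons, ih]
      simp; ring

lemma len_th (s : ℝ) (hs : 0 < s) (l : TL) : (th s l).length * s ^ 3 ≤ nn l := by
  induction l with
  | nil => simp [th]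
  | cons t l ih =>
    have hp := pn_nonneg t.2
    unfold th at *
    by_cases h : s ^ 2 ≤ ‖t.2‖
    · simp only [List.filter_cons, h, decide_true, if_true, List.length_cons, nn_cons]
      have h2 : s ≤ Real.sqrt ‖t.2‖ := Real.le_sqrt_of_sq_le h
      have : s ^ 3 ≤ pn t.2 := by
        unfold pn
        calc s ^ 3 = s ^ 2 * s := by ring
          _ ≤ _ := by gcongr
      push_cast; linarith
    · simp only [List.filter_cons, h, decide_false, nn_cons]
      simp only [Bool.false_eq_true, if_false]
      linarith

lemma en_dr (s : ℝ) (hs : 0 < s) (l : TL) : en (dr s l) ≤ s * nn l := by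
  induction l with
  | nil => simp [dr]
  | cons t l ih =>
    have hp := pn_nonneg t.2
    unfold dr at *
    by_cases h : s ^ 2 ≤ ‖t.2‖
    · simp only [List.filter_cons, h, not_true, decide_false, nn_cons]
      simp only [Bool.false_eq_true, if_false]
      nlinarith
    · simp only [List.filter_cons, h, not_false_iff, decide_true, if_true, nn_cons, en_cons]
      have h2 : Real.sqrt ‖t.2‖ ≤ s := (Real.sqrt_le_left hs.le).2 (not_le.1 h).le
      have : ‖t.2‖ ^ 2 ≤ s * pn t.2 := by
        unfold pn
        have e := Real.mul_self_sqrt (norm_nonneg t.2)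
        have n := norm_nonneg t.2
        have n2 := Real.sqrt_nonneg ‖t.2‖
        calc ‖t.2‖ ^ 2 = ‖t.2‖ * (Real.sqrt ‖t.2‖ * Real.sqrt ‖t.2‖) := by rw [e]; ring
          _ ≤ ‖t.2‖ * (s * Real.sqrt ‖t.2‖) := by gcongr
          _ = _ := by ring
      linarith

lemma en_th (s : ℝ) (l : TL) : en (th s l) ≤ en l := by
  induction l with
  | nil => simp [th]
  | cons t l ih =>
    have := sq_nonneg ‖t.2‖
    unfold th at *
    by_cases h : s ^ 2 ≤ ‖t.2‖
    · simp only [List.filter_cons, h, decide_true, if_true, en_cons]; linarith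
    · simp only [List.filter_cons, h, decide_false, en_cons]
      simp only [Bool.false_eq_true, if_false]
      linarith

lemma Sep.mono {M M' : ℤ} {l : TL} (h : Sep M l) (hM : M' ≤ M) : Sep M' l :=
  List.Pairwise.imp (fun hab => lt_of_le_of_lt hM hab) h

noncomputable def tht (s : ℝ) (T : List Nd) : List Nd := T.map (fun p => (p.1, th s p.2))

lemma fl_sub (s : ℝ) (T : List Nd) : (fl (tht s T)).Sublist (fl T) := by
  induction T with
  | nil => simp [tht]
  | cons p T ih =>
    have : tht s (p :: T) = (p.1, th s p.2) :: tht s T := rfl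
    rw [this, fl_cons, fl_cons]
    exact List.Sublist.append List.filter_sublist ih

lemma sub_fl {p : Nd} {T : List Nd} (h : p ∈ T) : p.2.Sublist (fl T) := by
  induction T with
  | nil => simp at h
  | cons q T ih =>
    rw [fl_cons]
    rcases List.mem_cons.1 h with rfl | h
    · exact List.sublist_append_left _ _
    · exact (ih h).trans (List.sublist_append_right _ _)

lemma len_fl {A : ℝ} (s : ℝ) (T : List Nd) (h : ∀ p ∈ T, ((th s p.2).length : ℝ) ≤ A) :
    ((fl (tht s T)).length : ℝ) ≤ T.length * A := by
  induction T with
  | nil => simp [tht]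
  | cons p T ih =>
    have e : tht s (p :: T) = (p.1, th s p.2) :: tht s T := rfl
    rw [e, fl_cons]
    have h1 := h p List.mem_cons_self
    have h2 := ih (fun q hq => h q (List.mem_cons_of_mem _ hq))
    simp only [List.length_append, List.length_cons]
    push_cast
    linarith

lemma en_fl (s : ℝ) (T : List Nd) : en (fl (tht s T)) ≤ en (fl T) := by
  induction T with
  | nil => simp [tht]
  | cons p T ih =>
    have e : tht s (p :: T) = (p.1, th s p.2) :: tht s T := rfl
    rw [e, fl_cons, fl_cons, en_append, en_append]
    exact add_le_add (en_th s p.2) ih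

lemma err_fl {η : ℝ} (s : ℝ) (T : List Nd) (x : Circ)
    (h : ∀ p ∈ T, ‖(p.1 x : ℂ) - ev (th s p.2) x‖ ≤ η) :
    ‖(sH T x : ℂ) - ev (fl (tht s T)) x‖ ≤ T.length * η := by
  induction T with
  | nil => simp [tht]
  | cons p T ih =>
    have e : tht s (p :: T) = (p.1, th s p.2) :: tht s T := rfl
    rw [e, fl_cons, sH_cons, ev_append]
    have h1 := h p List.mem_cons_self
    have h2 := ih (fun q hq => h q (List.mem_cons_of_mem _ hq))
    have e2 : ((p.1 x + sH T x : ℝ) : ℂ) - (ev (th s p.2) x + ev (fl (tht s T)) x) =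
      ((p.1 x : ℂ) - ev (th s p.2) x) + ((sH T x : ℂ) - ev (fl (tht s T)) x) := by
      push_cast; ring
    rw [e2]
    refine (norm_add_le _ _).trans ?_
    simp only [List.length_cons]
    push_cast
    linarith

lemma energy {δ : ℝ} (T : List Nd) (hm : ∀ p ∈ T, Measurable p.1) (hs : ∀ p ∈ T, Sep 0 p.2)
    (he : ∀ p ∈ T, I2 (fun x => (p.1 x : ℂ) - ev p.2 x) ≤ ENNReal.ofReal δ) :
    ENNReal.ofReal (en (fl T)) ≤ 2 * (∫⁻ x, ENNReal.ofReal (sH2 T x) ∂(haarAddCircle (T := (1:ℝ)))) +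
      T.length * (2 * ENNReal.ofReal δ) := by
  induction T with
  | nil => simp
  | cons p T ih =>
    have h2 := ih (fun q hq => hm q (List.mem_cons_of_mem _ hq))
      (fun q hq => hs q (List.mem_cons_of_mem _ hq)) (fun q hq => he q (List.mem_cons_of_mem _ hq))
    have hm1 := hm p List.mem_cons_self
    have key := I2_le (f := ev p.2) (g := fun x => (p.1 x : ℂ))
      (h := fun x => (p.1 x : ℂ) - ev p.2 x) (a := 2) (b := 2) (by norm_num) (by norm_num)
      (Complex.measurable_ofReal.comp hm1) (by
        intro x
        have := norm_sub_le (p.1 x : ℂ) ((p.1 x : ℂ) - ev p.2 x)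
        rw [sub_sub_cancel] at this
        calc _ ≤ (‖(p.1 x : ℂ)‖ + ‖(p.1 x : ℂ) - ev p.2 x‖) ^ 2 := by gcongr
          _ ≤ _ := by nlinarith [sq_nonneg (‖(p.1 x : ℂ)‖ - ‖(p.1 x : ℂ) - ev p.2 x‖)])
    rw [parseval _ (hs p List.mem_cons_self)] at key
    rw [fl_cons, en_append, ENNReal.ofReal_add (en_nonneg _) (en_nonneg _)]
    have e : ∫⁻ x, ENNReal.ofReal (sH2 (p :: T) x) ∂(haarAddCircle (T := (1:ℝ))) =
        I2 (fun x => (p.1 x : ℂ)) + ∫⁻ x, ENNReal.ofReal (sH2 T x) ∂(haarAddCircle (T := (1:ℝ))) := by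
      unfold I2
      rw [← lintegral_add_left (by fun_prop)]
      refine lintegral_congr fun x => ?_
      rw [sH2_cons, ENNReal.ofReal_add (sq_nonneg _) ?_]
      · simp
      · unfold sH2
        refine List.sum_nonneg ?_
        intro y hy
        obtain ⟨q, _, rfl⟩ := List.mem_map.1 hy
        exact sq_nonneg _
    rw [e]
    have h3 := he p List.mem_cons_self
    have e2 : ENNReal.ofReal 2 = 2 := by norm_num
    rw [e2] at key
    calc _ ≤ (2 * I2 (fun x => (p.1 x : ℂ)) + 2 * ENNReal.ofReal δ) +
          (2 * (∫⁻ x, ENNReal.ofReal (sH2 T x) ∂(haarAddCircle (T := (1:ℝ)))) +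
      T.length * (2 * ENNReal.ofReal δ)) := by
          refine add_le_add (key.trans ?_) h2
          gcongr
      _ = _ := by
        simp only [List.length_cons]
        push_cast
        ring

lemma union_bd {m : ENNReal} (A : Nd → Set Circ) (T : List Nd)
    (h : ∀ p ∈ T, haarAddCircle (T := (1:ℝ)) (A p) ≤ m) :
    haarAddCircle (T := (1:ℝ)) {x | ∃ p ∈ T, x ∈ A p} ≤ T.length * m := by
  induction T with
  | nil => simp
  | cons p T ih =>
    have h2 := ih (fun q hq => h q (List.mem_cons_of_mem _ hq))
    have : {x | ∃ q ∈ p :: T, x ∈ A q} = A p ∪ {x | ∃ q ∈ T, x ∈ A q} := by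
      ext x; simp
    rw [this]
    refine (measure_union_le _ _).trans ?_
    refine (add_le_add (h p List.mem_cons_self) h2).trans (le_of_eq ?_)
    simp only [List.length_cons]
    push_cast
    ring

lemma cheb (f : Circ → ℂ) (hf : Measurable f) (η A : ℝ) (hη : 0 < η)
    (h : I2 f ≤ ENNReal.ofReal A) :
    haarAddCircle (T := (1:ℝ)) {x | η < ‖f x‖} ≤ ENNReal.ofReal (A / η ^ 2) := by
  have h1 := mul_meas_ge_le_lintegral (μ := haarAddCircle (T := (1:ℝ)))
    (f := fun x => ENNReal.ofReal (‖f x‖ ^ 2)) (by fun_prop) (ENNReal.ofReal (η ^ 2))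
  have h2 : haarAddCircle (T := (1:ℝ)) {x | η < ‖f x‖} ≤
      haarAddCircle (T := (1:ℝ)) {x | ENNReal.ofReal (η ^ 2) ≤ ENNReal.ofReal (‖f x‖ ^ 2)} := by
    refine measure_mono fun x hx => ?_
    simp only [Set.mem_setOf_eq] at hx ⊢
    refine ENNReal.ofReal_le_ofReal ?_
    gcongr
  rw [ENNReal.ofReal_div_of_pos (by positivity)]
  rw [ENNReal.le_div_iff_mul_le (by left; simp; positivity) (by left; simp), mul_comm]
  exact (mul_le_mul_right h2 _).trans (h1.trans h)

lemma block : ∃ C : ℕ, 2 ≤ C ∧ ∀ d : ℕ, 4 ≤ d → ∀ R : ℤ, ∃ B : TL, B.length ≤ C ^ d ∧ Sep 0 B ∧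
    (∀ t ∈ B, R < t.1) ∧ en B ≤ 3 * d ∧ ∃ bad : Set Circ,
      haarAddCircle (T := (1:ℝ)) bad ≤ ENNReal.ofReal ((1/2) ^ d) ∧
      ∀ x ∉ bad, ∃ B1 B2, B = B1 ++ B2 ∧ ((d:ℝ) / 4 ≤ ‖ev B1 x‖ ∨ (d:ℝ) / 4 ≤ ‖ev B2 x‖) := by
  obtain ⟨K, hK, hT⟩ := exists_tree
  refine ⟨⌈2 * (K * (64 * K) ^ 3)⌉₊ + 2, by omega, fun d hd R => ?_⟩
  have hd' : (4:ℝ) ≤ d := by exact_mod_cast hd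
  set δ : ℝ := (1/64) ^ d with hδ
  have hδ0 : 0 < δ := by positivity
  obtain ⟨T, G⟩ := hT d 0 le_rfl δ hδ0
  set s : ℝ := ((64 * K) ^ d)⁻¹ with hs
  have hs0 : 0 < s := by positivity
  have hsep : ∀ p ∈ T, Sep 0 p.2 := fun p hp => G.sep.sublist (sub_fl hp)
  have hlenT : (T.length : ℝ) ≤ 2 ^ d := by exact_mod_cast G.len.le
  set F := fl (tht s T) with hF
  have hFsep : Sep 0 F := G.sep.sublist (fl_sub s T)
  obtain ⟨D, hD0, hD⟩ := exists_bd F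
  have hsd : s * K ^ d = δ := by
    rw [hs, hδ, mul_pow, one_div, inv_pow]; field_simp
  -- approximations
  have happ : ∀ p ∈ T, I2 (fun x => (p.1 x : ℂ) - ev (th s p.2) x) ≤ ENNReal.ofReal (4 * δ) := by
    intro p hp
    have key := I2_le (f := fun x => (p.1 x : ℂ) - ev (th s p.2) x)
      (g := fun x => (p.1 x : ℂ) - ev p.2 x) (h := ev (dr s p.2)) (a := 2) (b := 2)
      (by norm_num) (by norm_num) ((Complex.measurable_ofReal.comp (G.meas p hp)).sub (measurable_ev _)) (by
        intro x
        have e : (p.1 x : ℂ) - ev (th s p.2) x = ((p.1 x : ℂ) - ev p.2 x) + ev (dr s p.2) x := by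
          rw [ev_th s p.2 x]; ring
        rw [e]
        have := norm_add_le ((p.1 x : ℂ) - ev p.2 x) (ev (dr s p.2) x)
        calc _ ≤ (‖(p.1 x : ℂ) - ev p.2 x‖ + ‖ev (dr s p.2) x‖) ^ 2 := by gcongr
          _ ≤ _ := by nlinarith [sq_nonneg (‖(p.1 x : ℂ) - ev p.2 x‖ - ‖ev (dr s p.2) x‖)])
    have hdr : Sep 0 (dr s p.2) := (hsep p hp).sublist List.filter_sublist
    rw [parseval _ hdr] at key
    have h1 : en (dr s p.2) ≤ δ := by
      refine (en_dr s hs0 p.2).trans ?_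
      rw [← hsd]
      have := G.nnb p hp
      gcongr
    refine key.trans ?_
    have h2 := G.err p hp
    calc _ ≤ ENNReal.ofReal 2 * ENNReal.ofReal δ + ENNReal.ofReal 2 * ENNReal.ofReal δ := by gcongr
      _ = _ := by
        rw [← ENNReal.ofReal_mul (by norm_num), ← ENNReal.ofReal_add (by positivity) (by positivity)]
        congr 1; ring
  set η : ℝ := (1/2) ^ d with hη
  have hη0 : 0 < η := by positivity
  set A : Nd → Set Circ := fun p => {x | η < ‖(p.1 x : ℂ) - ev (th s p.2) x‖} with hA
  have hAm : ∀ p ∈ T, haarAddCircle (T := (1:ℝ)) (A p) ≤ ENNReal.ofReal (4 * δ / η ^ 2) := by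
    intro p hp
    exact cheb _ ((Complex.measurable_ofReal.comp (G.meas p hp)).sub (measurable_ev _)) η _ hη0 (happ p hp)
  refine ⟨F.map (fun t => (R + D + 1 + t.1, (1:ℂ) * t.2)), ?_, ?_, ?_, ?_,
    {x | ∃ p ∈ T, x ∈ A p}, ?_, ?_⟩
  · rw [List.length_map]
    have h1 : ∀ p ∈ T, ((th s p.2).length : ℝ) ≤ K ^ d * (64 * K) ^ (3 * d) := by
      intro p hp
      have h1 := (len_th s hs0 p.2).trans (G.nnb p hp)
      rw [← le_div_iff₀ (by positivity)] at h1
      refine h1.trans (le_of_eq ?_)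
      rw [hs, inv_pow, div_inv_eq_mul, ← pow_mul, mul_comm d 3]
    have h2 := len_fl s T h1
    have h3 : ((fl (tht s T)).length : ℝ) ≤ ((⌈2 * (K * (64 * K) ^ 3)⌉₊ + 2 : ℕ) : ℝ) ^ d := by
      calc _ ≤ _ := h2
        _ ≤ 2 ^ d * (K ^ d * (64 * K) ^ (3 * d)) := by gcongr
        _ = (2 * (K * (64 * K) ^ 3)) ^ d := by
          rw [pow_mul (64 * K) 3 d, ← mul_pow, ← mul_pow]
        _ ≤ _ := by
          gcongr
          push_cast
          have := Nat.le_ceil (2 * (K * (64 * K) ^ 3))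
          linarith
    exact_mod_cast h3
  · unfold Sep
    rw [List.pairwise_map]
    refine List.Pairwise.imp ?_ hFsep
    intro a b hab
    simpa using hab
  · intro t ht
    obtain ⟨u, hu, rfl⟩ := List.mem_map.1 ht
    have := abs_le.1 (hD u hu)
    simp only; linarith
  · have e : en (F.map (fun t => (R + D + 1 + t.1, (1:ℂ) * t.2))) = en F := by
      unfold en; rw [List.map_map]
      congr 1
      refine List.map_congr_left ?_
      intro t _; simp
    rw [e]
    refine (en_fl s T).trans ?_
    have h1 := energy T G.meas hsep G.err
    have h2 : ∫⁻ x, ENNReal.ofReal (sH2 T x) ∂(haarAddCircle (T := (1:ℝ))) ≤ ENNReal.ofReal d := by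
      calc _ ≤ ∫⁻ x, ENNReal.ofReal d ∂(haarAddCircle (T := (1:ℝ))) :=
            lintegral_mono fun x => ENNReal.ofReal_le_ofReal (G.sq x)
        _ = _ := by simp
    have h3 : ENNReal.ofReal (en (fl T)) ≤ ENNReal.ofReal (2 * d + 2 ^ d * (2 * δ)) := by
      refine h1.trans ?_
      rw [ENNReal.ofReal_add (by positivity) (by positivity), ENNReal.ofReal_mul (by norm_num),
        ENNReal.ofReal_mul (by positivity), ENNReal.ofReal_mul (by norm_num)]
      have e2 : ENNReal.ofReal 2 = 2 := by norm_num
      have e3 : (T.length : ENNReal) ≤ ENNReal.ofReal (2 ^ d) := by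
        rw [← ENNReal.ofReal_natCast]; exact ENNReal.ofReal_le_ofReal hlenT
      rw [e2]
      gcongr
    rw [ENNReal.ofReal_le_ofReal_iff (by positivity)] at h3
    have h4 : (2:ℝ) ^ d * (2 * δ) ≤ 2 := by
      rw [hδ]
      have : (2:ℝ) ^ d * (1/64) ^ d ≤ 1 := by
        rw [← mul_pow]; exact pow_le_one₀ (by norm_num) (by norm_num)
      linarith
    linarith
  · refine (union_bd A T hAm).trans ?_
    rw [← ENNReal.ofReal_natCast, ← ENNReal.ofReal_mul (by positivity)]
    refine ENNReal.ofReal_le_ofReal ?_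
    calc (T.length : ℝ) * (4 * δ / η ^ 2) ≤ 2 ^ d * (4 * δ / η ^ 2) := by gcongr
      _ = 4 * (1/8) ^ d := by
        rw [hδ, hη]
        have : (2:ℝ) ^ d * (4 * (1/64) ^ d / ((1/2) ^ d) ^ 2) = 4 * (2 * (1/64) / (1/2) ^ 2) ^ d := by
          rw [div_pow (2 * (1/64)), mul_pow 2, ← pow_mul, ← pow_mul, mul_comm 2 d]; ring
        rw [this]; norm_num
      _ ≤ 4 * ((1/4) ^ d * (1/2) ^ d) := by
        rw [← mul_pow]; norm_num
      _ ≤ 4 * ((1/4) ^ 1 * (1/2) ^ d) := by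
        have : ((1:ℝ)/4) ^ d ≤ (1/4) ^ 1 := pow_le_pow_of_le_one (by norm_num) (by norm_num) (by omega)
        gcongr
      _ = (1/2) ^ d := by ring
  · intro x hx
    have hx' : ∀ p ∈ T, ‖(p.1 x : ℂ) - ev (th s p.2) x‖ ≤ η := by
      intro p hp
      by_contra hcon
      exact hx ⟨p, hp, not_le.1 hcon⟩
    obtain ⟨T1, T2, hT12, hsum⟩ := G.split x
    refine ⟨(fl (tht s T1)).map (fun t => (R + D + 1 + t.1, (1:ℂ) * t.2)),
      (fl (tht s T2)).map (fun t => (R + D + 1 + t.1, (1:ℂ) * t.2)), ?_, ?_⟩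
    · rw [hF, hT12]; simp [tht]
    have hshift : ∀ l : TL, ‖ev (l.map (fun t => (R + D + 1 + t.1, (1:ℂ) * t.2))) x‖ = ‖ev l x‖ := by
      intro l
      have := ev_shift (R + D + 1, (1:ℂ)) l x
      simp only at this
      rw [this, norm_mul, norm_mul]
      have : ‖fourier (R + D + 1) x‖ = 1 := by rw [fourier_apply]; exact Circle.norm_coe _
      rw [this]; simp
    rw [hshift, hshift]
    have hle : ∀ S : List Nd, (∀ p ∈ S, p ∈ T) → S.length ≤ T.length →
        |sH S x| - 1 ≤ ‖ev (fl (tht s S)) x‖ := by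
      intro S hS hl
      have h1 := err_fl s S x (fun p hp => hx' p (hS p hp))
      have h2 : (S.length : ℝ) * η ≤ 1 := by
        have : (S.length : ℝ) ≤ T.length := by exact_mod_cast hl
        calc _ ≤ (2:ℝ) ^ d * η := by gcongr; linarith
          _ = 1 := by rw [hη, ← mul_pow]; norm_num
      have h3 := norm_sub_norm_le (sH S x : ℂ) (ev (fl (tht s S)) x)
      rw [Complex.norm_real, Real.norm_eq_abs] at h3
      linarith
    have b1 := hle T1 (fun p hp => by rw [hT12]; exact List.mem_append_left _ hp)
      (by rw [hT12, List.length_append]; omega)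
    have b2 := hle T2 (fun p hp => by rw [hT12]; exact List.mem_append_right _ hp)
      (by rw [hT12, List.length_append]; omega)
    by_contra hcon
    push Not at hcon
    have c1 := le_abs_self (sH T1 x)
    have c2 := neg_abs_le (sH T2 x)
    linarith [hcon.1, hcon.2]



lemma map_sum_getD {M : Type*} [AddCommMonoid M] (g : ℤ × ℂ → M) (L : TL) :
    (L.map g).sum = ∑ i ∈ Finset.range L.length, g (L.getD i (0, 0)) := by
  induction L with
  | nil => simp
  | cons t l ih => simp [Finset.sum_range_succ', ih, add_comm]

noncomputable def Wt (w : ℕ → ℝ) (L : TL) : ℝ :=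
  ∑ i ∈ Finset.range L.length, ‖(L.getD i (0, 0)).2‖ ^ 2 * w (i + 1)

lemma Wt_append (w : ℕ → ℝ) (hmono : ∀ m n, 1 ≤ m → m ≤ n → w m ≤ w n) (L E : TL) (N : ℕ)
    (hN : (L ++ E).length ≤ N) : Wt w (L ++ E) ≤ Wt w L + en E * w N := by
  unfold Wt en
  rw [map_sum_getD, List.length_append, Finset.sum_range_add, Finset.sum_mul]
  rw [List.length_append] at hN
  refine add_le_add (le_of_eq ?_) ?_
  · refine Finset.sum_congr rfl fun i hi => ?_
    rw [List.getD_append _ _ _ _ (Finset.mem_range.1 hi)]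
  · refine Finset.sum_le_sum fun i hi => ?_
    have hi' := Finset.mem_range.1 hi
    rw [List.getD_append_right _ _ _ _ (by omega), Nat.add_sub_cancel_left]
    exact mul_le_mul_of_nonneg_left (hmono _ _ (by omega) (by omega)) (by positivity)

def Ok (L : TL) : Prop := Sep 0 L ∧ ∀ t ∈ L, 1 ≤ t.1

def Osc (E : TL) (x : Circ) : Prop := ∃ E1 E2 E3, E = E1 ++ E2 ++ E3 ∧ 1 ≤ ‖ev E2 x‖

lemma ev_scale (c : ℂ) (B : TL) (x : Circ) :
    ev (B.map (fun t => (t.1, c * t.2))) x = c * ev B x := by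
  induction B with
  | nil => simp
  | cons t l ih => simp [ih]; ring

lemma en_scale (c : ℂ) (B : TL) :
    en (B.map (fun t => (t.1, c * t.2))) = ‖c‖ ^ 2 * en B := by
  induction B with
  | nil => simp
  | cons t l ih => simp [ih]; ring

lemma sep_append {L E : TL} {D : ℤ} (hL : Sep 0 L) (hE : Sep 0 E) (h1 : ∀ t ∈ L, t.1 ≤ D)
    (h2 : ∀ t ∈ E, D < t.1) : Sep 0 (L ++ E) := by
  unfold Sep
  rw [List.pairwise_append]
  refine ⟨hL, hE, fun a ha b hb => ?_⟩
  have := h1 a ha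
  have := h2 b hb
  rw [abs_pos]; omega

lemma add_freq (k : ℕ) (L : TL) (hL : Ok L) : ∃ G : TL, Ok (L ++ G) ∧ G ≠ [] ∧ G.length ≤ 2 ∧
    en G = 0 ∧ ∃ t ∈ L ++ G, t.1 = (k : ℤ) + 1 := by
  have key : ∃ G : TL, Ok (L ++ G) ∧ G.length ≤ 1 ∧
    en G = 0 ∧ ∃ t ∈ L ++ G, t.1 = (k : ℤ) + 1 := by
    by_cases h : ∃ t ∈ L, t.1 = (k : ℤ) + 1
    · exact ⟨[], by simpa using hL, by simp, by simp, by simpa using h⟩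
    · refine ⟨[((k : ℤ) + 1, 0)], ⟨?_, ?_⟩, by simp, by simp, _,
        List.mem_append_right _ (List.mem_singleton_self _), rfl⟩
      · unfold Sep
        rw [List.pairwise_append]
        refine ⟨hL.1, by simp, fun a ha b hb => ?_⟩
        rw [List.mem_singleton] at hb
        subst hb
        rw [abs_pos]
        intro h'
        exact h ⟨a, ha, by simp only at h'; omega⟩
      · intro t ht
        rcases List.mem_append.1 ht with ht | ht
        · exact hL.2 t ht
        · rw [List.mem_singleton] at ht
          subst ht
          simp only; omega
  obtain ⟨G, h1, h2, h3, t, h4, h5⟩ := key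
  obtain ⟨D, hD0, hD⟩ := exists_bd (L ++ G)
  refine ⟨G ++ [(D + 1, 0)], ?_, by simp, by simpa using h2, by simp [h3], t, ?_, h5⟩
  · rw [← List.append_assoc]
    refine ⟨sep_append (D := D) h1.1 (by simp [Sep]) (fun t ht => (abs_le.1 (hD t ht)).2) ?_, ?_⟩
    · simp
    · intro t ht
      rcases List.mem_append.1 ht with ht | ht
      · exact h1.2 t ht
      · rw [List.mem_singleton] at ht
        subst ht
        simp only; omega
  · rw [← List.append_assoc]; exact List.mem_append_left _ h4

lemma stage (w : ℕ → ℝ) (hpos : ∀ n, 1 ≤ n → 0 < w n)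
    (hmono : ∀ m n, 1 ≤ m → m ≤ n → w m ≤ w n)
    (ho : (fun n : ℕ => w n) =o[atTop] (fun n : ℕ => Real.log n)) (k : ℕ) (L : TL) (hL : Ok L) :
    ∃ E : TL, Ok (L ++ E) ∧ (∃ t ∈ L ++ E, t.1 = (k : ℤ) + 1) ∧ E ≠ [] ∧
      Wt w (L ++ E) ≤ Wt w L + (1/2) ^ k ∧ ∃ bad : Set Circ,
        haarAddCircle (T := (1:ℝ)) bad ≤ ENNReal.ofReal ((1/2) ^ k) ∧ ∀ x ∉ bad, Osc E x := by
  obtain ⟨C, hC, hblock⟩ := block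
  obtain ⟨G, hG, hG0, hG2, hGe, t0, ht0, ht0'⟩ := add_freq k L hL
  obtain ⟨D, hD0, hD⟩ := exists_bd (L ++ G)
  have hC2 : (2:ℝ) ≤ C := by exact_mod_cast hC
  have hlog : 0 < Real.log C := Real.log_pos (by linarith)
  set ε : ℝ := (1/2) ^ k / (96 * Real.log C) with hε
  have hε0 : 0 < ε := by positivity
  obtain ⟨N0, hN0⟩ := eventually_atTop.1 (ho.bound hε0)
  set d : ℕ := 4 + k + L.length + 2 + N0 with hd
  have hdC : d < C ^ d := Nat.lt_pow_self (by omega)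
  have hdC1 : 2 * C ^ d ≤ C ^ (d + 1) := by rw [pow_succ, mul_comm]; gcongr
  have hd0 : (0:ℝ) < d := by
    have : 0 < d := by omega
    exact_mod_cast this
  have hw : w (C ^ (d + 1)) ≤ ε * ((d + 1) * Real.log C) := by
    have := hN0 (C ^ (d + 1)) (by omega)
    simp only [Nat.cast_pow, Real.log_pow] at this
    rw [Real.norm_of_nonneg (hpos _ (by omega)).le, Real.norm_of_nonneg (by positivity)] at this
    push_cast at this
    exact this
  obtain ⟨B, hBl, hBs, hBR, hBe, bad, hbad, hosc⟩ := hblock d (by omega) D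
  set c : ℂ := ((4 / d : ℝ) : ℂ) with hc
  have hcn : ‖c‖ = 4 / d := by
    rw [hc, Complex.norm_real, Real.norm_of_nonneg (by positivity)]
  set f : ℤ × ℂ → ℤ × ℂ := fun t => (t.1, c * t.2) with hf
  have hmemB : ∀ t ∈ B.map f, D < t.1 := by
    intro t ht
    obtain ⟨u, hu, rfl⟩ := List.mem_map.1 ht
    exact hBR u hu
  refine ⟨G ++ B.map f, ?_, ⟨t0, ?_, ht0'⟩, by simp [hG0], ?_, bad, ?_, ?_⟩
  · rw [← List.append_assoc]
    refine ⟨sep_append (D := D) hG.1 ?_ (fun t ht => (abs_le.1 (hD t ht)).2) hmemB, ?_⟩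
    · unfold Sep
      rw [List.pairwise_map]
      exact hBs
    · intro t ht
      rcases List.mem_append.1 ht with ht | ht
      · exact hG.2 t ht
      · have := hmemB t ht; omega
  · rw [← List.append_assoc]; exact List.mem_append_left _ ht0
  · refine (Wt_append w hmono _ _ (C ^ (d + 1)) ?_).trans ?_
    · simp only [List.length_append, List.length_map]; omega
    · rw [en_append, hGe, zero_add, en_scale, hcn]
      gcongr
      have hw0 : 0 ≤ w (C ^ (d + 1)) := (hpos _ (by omega)).le
      calc (4 / d : ℝ) ^ 2 * en B * w (C ^ (d + 1))
          ≤ (4 / d : ℝ) ^ 2 * (3 * d) * (ε * ((d + 1) * Real.log C)) := by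
            have := en_nonneg B
            gcongr
        _ ≤ (4 / d : ℝ) ^ 2 * (3 * d) * (ε * ((d + d) * Real.log C)) := by
            have : (1:ℝ) ≤ d := by
              have : 1 ≤ d := by omega
              exact_mod_cast this
            gcongr
        _ = (1/2) ^ k := by
            rw [hε]; field_simp; norm_num
  · refine hbad.trans (ENNReal.ofReal_le_ofReal ?_)
    exact pow_le_pow_of_le_one (by norm_num) (by norm_num) (by omega)
  · intro x hx
    obtain ⟨B1, B2, hB, h⟩ := hosc x hx
    have key : ∀ B' : TL, (d:ℝ)/4 ≤ ‖ev B' x‖ → 1 ≤ ‖ev (B'.map f) x‖ := by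
      intro B' h
      rw [ev_scale, norm_mul, hcn]
      calc (1:ℝ) = 4 / d * (d / 4) := by field_simp
        _ ≤ _ := by gcongr
    rcases h with h | h
    · exact ⟨G, B1.map f, B2.map f, by simp [hB], key _ h⟩
    · exact ⟨G ++ B1.map f, B2.map f, [], by simp [hB], key _ h⟩


lemma exists_seq (w : ℕ → ℝ) (hpos : ∀ n, 1 ≤ n → 0 < w n)
    (hmono : ∀ m n, 1 ≤ m → m ≤ n → w m ≤ w n)
    (ho : (fun n : ℕ => w n) =o[atTop] (fun n : ℕ => Real.log n)) :
    ∃ (LL EE : ℕ → TL) (bad : ℕ → Set Circ), LL 0 = [] ∧ (∀ k, LL (k + 1) = LL k ++ EE k) ∧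
      (∀ k, Ok (LL k)) ∧ (∀ k : ℕ, ∃ t ∈ LL (k + 1), t.1 = (k : ℤ) + 1) ∧ (∀ k, EE k ≠ []) ∧
      (∀ k, Wt w (LL (k + 1)) ≤ Wt w (LL k) + (1/2) ^ k) ∧
      (∀ k, haarAddCircle (T := (1:ℝ)) (bad k) ≤ ENNReal.ofReal ((1/2) ^ k)) ∧
      ∀ k, ∀ x ∉ bad k, Osc (EE k) x := by
  choose E h1 h2 h3 h4 bad h5 h6 using stage w hpos hmono ho
  let S : ℕ → {L : TL // Ok L} := fun k => Nat.rec ⟨[], by simp [Ok, Sep]⟩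
    (fun k L => ⟨L.1 ++ E k L.1 L.2, h1 k L.1 L.2⟩) k
  exact ⟨fun k => (S k).1, fun k => E k (S k).1 (S k).2, fun k => bad k (S k).1 (S k).2, rfl,
    fun k => rfl, fun k => (S k).2, fun k => h2 k _ _, fun k => h3 k _ _, fun k => h4 k _ _,
    fun k => h5 k _ _, fun k => h6 k _ _⟩

lemma ev_eq_sum (L : TL) (x : Circ) : ev L x =
    ∑ i ∈ Finset.range L.length, (L.getD i (0, 0)).2 * fourier (L.getD i (0, 0)).1 x := by
  unfold ev
  rw [map_sum_getD]

lemma exists_fun (w : ℕ → ℝ) (hpos : ∀ n, 1 ≤ n → 0 < w n)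
    (hmono : ∀ m n, 1 ≤ m → m ≤ n → w m ≤ w n)
    (ho : (fun n : ℕ => w n) =o[atTop] (fun n : ℕ => Real.log n)) :
    ∃ f : ℕ → ℤ × ℂ, Function.Injective (fun i => (f i).1) ∧ (∀ i, 1 ≤ (f i).1) ∧
      (∀ k : ℕ, ∃ i, (f i).1 = (k : ℤ) + 1) ∧ Summable (fun i => ‖(f i).2‖ ^ 2 * w (i + 1)) ∧
      ∃ bad : ℕ → Set Circ,
        (∀ k, haarAddCircle (T := (1:ℝ)) (bad k) ≤ ENNReal.ofReal ((1/2) ^ k)) ∧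
        ∀ k, ∀ x ∉ bad k, ∃ m1 m2, k ≤ m1 ∧ k ≤ m2 ∧
          1 ≤ ‖∑ i ∈ Finset.range m2, (f i).2 * fourier (f i).1 x -
            ∑ i ∈ Finset.range m1, (f i).2 * fourier (f i).1 x‖ := by
  obtain ⟨LL, EE, bad, h0, hS, hOk, hsurj, hne, hW, hbad, hosc⟩ := exists_seq w hpos hmono ho
  have hlen : ∀ k, k ≤ (LL k).length := by
    intro k
    induction k with
    | zero => simp
    | succ k ih =>
      have := List.length_pos_iff.2 (hne k)
      rw [hS, List.length_append]; omega
  have hpre : ∀ k l, k ≤ l → LL k <+: LL l := by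
    intro k l hkl
    induction l, hkl using Nat.le_induction with
    | base => exact List.prefix_rfl
    | succ l _ ih => rw [hS]; exact ih.trans (List.prefix_append _ _)
  set f : ℕ → ℤ × ℂ := fun i => (LL (i + 1)).getD i (0, 0) with hf
  have pre_getD : ∀ (A B : TL) (i : ℕ), A <+: B → i < A.length →
      B.getD i (0, 0) = A.getD i (0, 0) := by
    rintro A _ i ⟨C, rfl⟩ hi
    exact List.getD_append _ _ _ _ hi
  have hfe : ∀ k i, i < (LL k).length → f i = (LL k).getD i (0, 0) := by
    intro k i hi
    rcases le_total k (i + 1) with h | h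
    · exact pre_getD _ _ _ (hpre _ _ h) hi
    · exact (pre_getD _ _ _ (hpre _ _ h) (by have := hlen (i + 1); omega)).symm
  have hfl : ∀ k i (hi : i < (LL k).length), f i = (LL k)[i] := by
    intro k i hi
    rw [hfe k i hi, List.getD_eq_getElem _ _ hi]
  refine ⟨f, ?_, ?_, ?_, ?_, bad, hbad, ?_⟩
  · have key : ∀ i j, i < j → (f i).1 ≠ (f j).1 := by
      intro i j hij
      have hj := hlen (j + 1)
      rw [hfl (j + 1) i (by omega), hfl (j + 1) j (by omega)]
      have := List.pairwise_iff_getElem.1 (hOk (j + 1)).1 i j (by omega) (by omega) hij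
      intro h
      rw [h] at this
      simp at this
    intro i j hij
    rcases lt_trichotomy i j with h | h | h
    · exact absurd hij (key i j h)
    · exact h
    · exact absurd hij.symm (key j i h)
  · intro i
    have hi := hlen (i + 1)
    rw [hfl (i + 1) i (by omega)]
    exact (hOk _).2 _ (List.getElem_mem _)
  · intro k
    obtain ⟨t, ht, ht'⟩ := hsurj k
    obtain ⟨i, hi, rfl⟩ := List.getElem_of_mem ht
    exact ⟨i, by rw [hfl _ i hi]; exact ht'⟩
  · have hW2 : ∀ k, Wt w (LL k) ≤ 2 - 2 * (1/2) ^ k := by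
      intro k
      induction k with
      | zero => rw [h0]; simp [Wt]
      | succ k ih =>
        have := hW k
        rw [pow_succ]; linarith
    have hnn : ∀ i, 0 ≤ ‖(f i).2‖ ^ 2 * w (i + 1) := fun i =>
      mul_nonneg (by positivity) (hpos _ (by omega)).le
    refine summable_of_sum_range_le (c := 2) hnn fun n => ?_
    calc ∑ i ∈ Finset.range n, ‖(f i).2‖ ^ 2 * w (i + 1)
        ≤ ∑ i ∈ Finset.range (LL n).length, ‖(f i).2‖ ^ 2 * w (i + 1) :=
          Finset.sum_le_sum_of_subset_of_nonneg (Finset.range_mono (hlen n))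
            fun i _ _ => hnn i
      _ = Wt w (LL n) := by
          unfold Wt
          refine Finset.sum_congr rfl fun i hi => ?_
          rw [hfe n i (Finset.mem_range.1 hi)]
      _ ≤ 2 := by
          have := hW2 n
          have : (0:ℝ) < (1/2) ^ n := by positivity
          linarith
  · intro k x hx
    obtain ⟨E1, E2, E3, hE, h⟩ := hosc k x hx
    have hsum : ∀ A : TL, A <+: LL (k + 1) →
        ∑ i ∈ Finset.range A.length, (f i).2 * fourier (f i).1 x = ev A x := by
      intro A hA
      rw [ev_eq_sum]
      refine Finset.sum_congr rfl fun i hi => ?_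
      have hi := Finset.mem_range.1 hi
      rw [hfe (k + 1) i (hi.trans_le hA.length_le), pre_getD _ _ _ hA hi]
    have hk := hlen k
    refine ⟨(LL k ++ E1).length, (LL k ++ E1 ++ E2).length, ?_, ?_, ?_⟩
    · rw [List.length_append]; omega
    · rw [List.length_append, List.length_append]; omega
    · rw [hsum (LL k ++ E1) ⟨E2 ++ E3, by simp [hS, hE]⟩,
        hsum (LL k ++ E1 ++ E2) ⟨E3, by simp [hS, hE]⟩, ev_append _ E2,
        add_sub_cancel_left]
      exact h

lemma trig_eq (n : ℤ) (x : ℝ) : trigChar n x = fourier n (x : Circ) := by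
  rw [fourier_coe_apply]
  unfold trigChar
  simp

lemma ae_transfer {p : Circ → Prop} (h : ∀ᵐ x ∂(haarAddCircle (T := (1:ℝ))), p x) :
    ∀ᵐ x : ℝ ∂(volume.restrict (Set.Ioc (0:ℝ) 1)), p ((x : ℝ) : Circ) := by
  have hv : ∀ᵐ x ∂(volume : Measure Circ), p x := by
    rw [AddCircle.volume_eq_smul_haarAddCircle]
    exact Measure.ae_smul_measure h _
  have := (UnitAddCircle.measurePreserving_mk 0).quasiMeasurePreserving.ae hv
  simpa using this

lemma main (w : ℕ → ℝ) (hpos : ∀ n, 1 ≤ n → 0 < w n)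
    (hmono : ∀ m n, 1 ≤ m → m ≤ n → w m ≤ w n)
    (ho : (fun n : ℕ => w n) =o[atTop] (fun n : ℕ => Real.log n)) :
    ∃ a : ℕ → ℂ, Summable (fun n : ℕ => ‖a n‖ ^ 2 * w n) ∧
      ∃ σ : ℕ → ℕ, Set.BijOn σ {n : ℕ | 1 ≤ n} {n : ℕ | 1 ≤ n} ∧
        ∀ᵐ x ∂(volume.restrict (Set.Ioc (0:ℝ) 1)),
          ¬ ∃ L : ℂ, Tendsto (fun m : ℕ => ∑ n ∈ Finset.Icc 1 m, a n * trigChar (σ n : ℤ) x)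
            atTop (nhds L) := by
  obtain ⟨f, hinj, hf1, hsurj, hsum, bad, hbad, hosc⟩ := exists_fun w hpos hmono ho
  refine ⟨fun n => if n = 0 then 0 else (f (n - 1)).2, ?_, fun n => (f (n - 1)).1.toNat,
    ⟨?_, ?_, ?_⟩, ?_⟩
  · rw [← summable_nat_add_iff 1]
    simpa using hsum
  · intro n _
    have := hf1 (n - 1)
    change 1 ≤ (f (n - 1)).1.toNat
    omega
  · intro m hm n hn hmn
    have hm : 1 ≤ m := hm
    have hn : 1 ≤ n := hn
    have h1 := hf1 (m - 1)
    have h2 := hf1 (n - 1)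
    have hmn : (f (m - 1)).1.toNat = (f (n - 1)).1.toNat := hmn
    have := @hinj (m - 1) (n - 1) (by simp only; omega)
    omega
  · intro n hn
    have hn : 1 ≤ n := hn
    obtain ⟨i, hi⟩ := hsurj (n - 1)
    refine ⟨i + 1, by simp, ?_⟩
    simp only [Nat.add_sub_cancel]
    omega
  · have hfin : ∑' k, haarAddCircle (T := (1:ℝ)) (bad k) ≠ ⊤ := by
      refine ne_top_of_le_ne_top ?_ (ENNReal.tsum_le_tsum hbad)
      rw [← ENNReal.ofReal_tsum_of_nonneg (fun n => by positivity) summable_geometric_two]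
      exact ENNReal.ofReal_ne_top
    filter_upwards [ae_transfer (ae_eventually_notMem hfin)] with x hx
    rintro ⟨L, hL⟩
    have hL2 : Tendsto (fun m : ℕ => ∑ i ∈ Finset.range m, (f i).2 * fourier (f i).1 (x : Circ))
        atTop (nhds L) := by
      refine hL.congr fun m => ?_
      induction m with
      | zero => simp
      | succ m ih =>
        have hm := hf1 m
        rw [Finset.sum_Icc_succ_top (by omega), ih, Finset.sum_range_succ, trig_eq]
        simp only [Nat.add_sub_cancel, Nat.succ_ne_zero, if_false, Int.toNat_of_nonneg
          (show 0 ≤ (f m).1 by omega)]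
    obtain ⟨N, hN⟩ := Metric.cauchySeq_iff.1 hL2.cauchySeq 1 one_pos
    obtain ⟨k, hk1, hk2⟩ := (hx.and (eventually_ge_atTop N)).exists
    obtain ⟨m1, m2, h1, h2, h3⟩ := hosc k _ hk1
    have := hN m2 (by omega) m1 (by omega)
    rw [dist_eq_norm] at this
    linarith

end WM

/-- If `w(n)` is an increasing sequence of positive numbers with `w(n) = o(log n)`, then there
are coefficients with `∑ |a_n|² w(n) < ∞` and a permutation `σ` of the positive integers such
that `∑ a_n e^{2πiσ(n)x}` diverges almost everywhere on `𝕋 = ℝ/ℤ`. -/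
theorem statement2 (w : ℕ → ℝ) (hpos : ∀ n, 1 ≤ n → 0 < w n)
    (hmono : ∀ m n, 1 ≤ m → m ≤ n → w m ≤ w n)
    (ho : (fun n : ℕ => w n) =o[atTop] (fun n : ℕ => Real.log n)) :
    ∃ a : ℕ → ℂ, Summable (fun n : ℕ => ‖a n‖ ^ 2 * w n) ∧
      ∃ σ : ℕ → ℕ, Set.BijOn σ {n : ℕ | 1 ≤ n} {n : ℕ | 1 ≤ n} ∧
        ∀ᵐ x ∂(volume.restrict (Set.Ioc (0:ℝ) 1)),
          ¬ ∃ L : ℂ, Tendsto (fun m : ℕ => ∑ n ∈ Finset.Icc 1 m, a n * trigChar (σ n : ℤ) x)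
            atTop (nhds L) := by
  exact WM.main w hpos hmono ho
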